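/- (Submodularity part of Proposition 3.) Fix a player i and the strategies s_{-i} of all other players. The utility function s_i ↦ π_i(s_i, s_{-i}) is submodular: for all sets X ⊆ Y ⊆ V and every node u ∈ V ∖ Y, π_i(X ∪ {u}, s_{-i}) − π_i(X, s_{-i}) ≥ π_i(Y ∪ {u}, s_{-i}) − π_i(Y, s_{-i}). -/

import Mathlib

open Finset

/-- `seedCount s u` is `m_u(s)`, the number of players that include node `u`
in their seed set. -/
def seedCount {m n : ℕ} (s : Fin m → Finset (Fin n)) (u : Fin n) : ℕ :=
  (Finset.univ.filter (fun j => u ∈ s j)).card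

/-- `seeded s` is `V_s`, the set of nodes seeded by at least one player. -/
def seeded {m n : ℕ} (s : Fin m → Finset (Fin n)) : Finset (Fin n) :=
  Finset.univ.biUnion s

/-- `fPart c ε s i v` is `f^i_v(s) = Σ_{u ∈ s_i} c^u_v / m_u(s) + Σ_{u ∈ V ∖ V_s} ε·c^u_v`. -/
noncomputable def fPart {m n : ℕ} (c : Fin n → Fin n → ℝ) (ε : ℝ) (s : Fin m → Finset (Fin n))
    (i : Fin m) (v : Fin n) : ℝ :=
  (∑ u ∈ s i, c u v / (seedCount s u : ℝ)) + ∑ u ∈ Finset.univ \ seeded s, ε * c u v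

/-- `fTot c ε s v` is `f_v(s) = Σ_{j ∈ M} f^j_v(s)`. -/
noncomputable def fTot {m n : ℕ} (c : Fin n → Fin n → ℝ) (ε : ℝ) (s : Fin m → Finset (Fin n))
    (v : Fin n) : ℝ :=
  ∑ j : Fin m, fPart c ε s j v

/-- `gPart c ε s i v` is `g^i_v(s) = f^i_v(s) / f_v(s)`. -/
noncomputable def gPart {m n : ℕ} (c : Fin n → Fin n → ℝ) (ε : ℝ) (s : Fin m → Finset (Fin n))
    (i : Fin m) (v : Fin n) : ℝ :=
  fPart c ε s i v / fTot c ε s v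

/-- `payoff c ε s i` is the utility `π_i(s) = (1/n) Σ_{v ∈ V} g^i_v(s)`. -/
noncomputable def payoff {m n : ℕ} (c : Fin n → Fin n → ℝ) (ε : ℝ) (s : Fin m → Finset (Fin n))
    (i : Fin m) : ℝ :=
  (1 / (n : ℝ)) * ∑ v : Fin n, gPart c ε s i v

theorem mem_seeded_iff_seedCount_ne_zero {m n : ℕ} (s : Fin m → Finset (Fin n)) (w : Fin n) :
    w ∈ seeded s ↔ seedCount s w ≠ 0 := by
  simp [seeded, seedCount, Finset.filter_eq_empty_iff]

theorem fPart_eq_sum {m n : ℕ} (c : Fin n → Fin n → ℝ) (ε : ℝ) (s : Fin m → Finset (Fin n))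
    (i : Fin m) (v : Fin n) :
    fPart c ε s i v = ∑ w, ((if w ∈ s i then c w v / (seedCount s w : ℝ) else 0) +
      if seedCount s w = 0 then ε * c w v else 0) := by
  have h : Finset.univ \ seeded s = Finset.univ.filter (fun w => seedCount s w = 0) := by
    ext w
    simp [mem_seeded_iff_seedCount_ne_zero]
  rw [fPart, h, Finset.sum_add_distrib, Finset.sum_filter, Finset.sum_ite_mem, Finset.univ_inter]

/-- The total influence on `v` counts seeded nodes with weight one and all other nodes with
weight `m * ε`. -/
theorem fTot_eq_sum {m n : ℕ} (c : Fin n → Fin n → ℝ) (ε : ℝ) (s : Fin m → Finset (Fin n))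
    (v : Fin n) :
    fTot c ε s v = ∑ w, if seedCount s w = 0 then m * ε * c w v else c w v := by
  simp only [fTot, fPart_eq_sum]
  rw [Finset.sum_comm]
  refine Finset.sum_congr rfl fun w _ => ?_
  rw [Finset.sum_add_distrib, ← Finset.sum_filter, Finset.sum_const, Finset.sum_const]
  change seedCount s w • _ + _ = _
  by_cases h : seedCount s w = 0
  · simp [h, mul_assoc]
  · have h' : (seedCount s w : ℝ) ≠ 0 := by exact_mod_cast h
    simp only [h, if_false, nsmul_eq_mul, mul_zero, add_zero]
    field_simp

theorem fPart_nonneg {m n : ℕ} {c : Fin n → Fin n → ℝ} (hc : ∀ u v, 0 ≤ c u v) {ε : ℝ}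
    (hε : 0 ≤ ε) (s : Fin m → Finset (Fin n)) (i : Fin m) (v : Fin n) :
    0 ≤ fPart c ε s i v :=
  add_nonneg (Finset.sum_nonneg fun w _ => div_nonneg (hc w v) (Nat.cast_nonneg _))
    (Finset.sum_nonneg fun w _ => mul_nonneg hε (hc w v))

theorem fPart_le_fTot {m n : ℕ} {c : Fin n → Fin n → ℝ} (hc : ∀ u v, 0 ≤ c u v) {ε : ℝ}
    (hε : 0 ≤ ε) (s : Fin m → Finset (Fin n)) (i : Fin m) (v : Fin n) :
    fPart c ε s i v ≤ fTot c ε s v :=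
  Finset.single_le_sum (f := fun j => fPart c ε s j v)
    (fun j _ => fPart_nonneg hc hε s j v) (Finset.mem_univ i)

theorem seedCount_update {m n : ℕ} (s : Fin m → Finset (Fin n)) (i : Fin m)
    (S : Finset (Fin n)) (w : Fin n) :
    seedCount (Function.update s i S) w =
      seedCount (Function.update s i ∅) w + if w ∈ S then 1 else 0 := by
  simp only [seedCount, Finset.card_filter]
  rw [← Finset.add_sum_erase _ _ (Finset.mem_univ i),
    ← Finset.add_sum_erase (a := i) (f := fun j => if w ∈ Function.update s i ∅ j then 1 else 0)
      _ (Finset.mem_univ i)]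
  simp only [Function.update_self, Finset.notMem_empty, if_false, zero_add]
  rw [add_comm]
  congr 1
  refine Finset.sum_congr rfl fun j hj => ?_
  rw [Function.update_of_ne (Finset.ne_of_mem_erase hj),
    Function.update_of_ne (Finset.ne_of_mem_erase hj)]

theorem fPart_update {m n : ℕ} (c : Fin n → Fin n → ℝ) (ε : ℝ) (s : Fin m → Finset (Fin n))
    (i : Fin m) (S : Finset (Fin n)) (v : Fin n) :
    fPart c ε (Function.update s i S) i v = fPart c ε (Function.update s i ∅) i v +
      ∑ w ∈ S, if seedCount (Function.update s i ∅) w = 0 then (1 - ε) * c w v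
        else c w v / (seedCount (Function.update s i ∅) w + 1 : ℝ) := by
  rw [fPart_eq_sum, fPart_eq_sum, ← Finset.univ_inter S, ← Finset.sum_ite_mem,
    ← Finset.sum_add_distrib, Finset.univ_inter]
  refine Finset.sum_congr rfl fun w _ => ?_
  rw [seedCount_update s i S w]
  by_cases hw : w ∈ S <;> by_cases hk : seedCount (Function.update s i ∅) w = 0 <;>
    simp [hw, hk]
  ring

theorem fTot_update {m n : ℕ} (c : Fin n → Fin n → ℝ) (ε : ℝ) (s : Fin m → Finset (Fin n))
    (i : Fin m) (S : Finset (Fin n)) (v : Fin n) :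
    fTot c ε (Function.update s i S) v = fTot c ε (Function.update s i ∅) v +
      ∑ w ∈ S, if seedCount (Function.update s i ∅) w = 0 then (1 - m * ε) * c w v else 0 := by
  rw [fTot_eq_sum, fTot_eq_sum, ← Finset.univ_inter S, ← Finset.sum_ite_mem,
    ← Finset.sum_add_distrib, Finset.univ_inter]
  refine Finset.sum_congr rfl fun w _ => ?_
  rw [seedCount_update s i S w]
  by_cases hw : w ∈ S <;> by_cases hk : seedCount (Function.update s i ∅) w = 0 <;>
    simp [hw, hk]
  ring

theorem fTot_pos {m n : ℕ} (hm : 0 < m) {c : Fin n → Fin n → ℝ} (hc : ∀ u v, 0 ≤ c u v)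
    (hcsum : ∀ v, ∑ u, c u v = 1) {ε : ℝ} (hε : 0 < ε) (hmε : m * ε ≤ 1)
    (s : Fin m → Finset (Fin n)) (v : Fin n) : 0 < fTot c ε s v := by
  have hm' : (0 : ℝ) < m := by exact_mod_cast hm
  calc 0 < m * ε * ∑ w, c w v := by rw [hcsum]; positivity
    _ ≤ fTot c ε s v := by
      rw [fTot_eq_sum, Finset.mul_sum]
      refine Finset.sum_le_sum fun w _ => ?_
      split_ifs
      · exact le_rfl
      · exact mul_le_of_le_one_left (hc w v) hmε

/-- Diminishing returns of a ratio at most one: adding `a` to the numerator and `b ≤ a` to the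
denominator gains less after `p` and `q ≤ p` have been added. -/
theorem div_sub_div_le_of_add {A B a b p q : ℝ} (hB : 0 < B) (hAB : A ≤ B) (hb : 0 ≤ b)
    (hba : b ≤ a) (hq : 0 ≤ q) (hqp : q ≤ p) :
    (A + p + a) / (B + q + b) - (A + p) / (B + q) ≤ (A + a) / (B + b) - A / B := by
  have key : ∀ {A B : ℝ}, 0 < B → (A + a) / (B + b) - A / B =
      (a - b) / (B + b) + b * (B - A) / (B * (B + b)) := by
    intro A B hB
    have : B + b ≠ 0 := by positivity
    field_simp
    ring
  rw [key hB, key (show 0 < B + q by positivity)]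
  have hab : 0 ≤ a - b := sub_nonneg.2 hba
  have hD : 0 ≤ b * (B - A) := mul_nonneg hb (sub_nonneg.2 hAB)
  have hD' : b * (B + q - (A + p)) ≤ b * (B - A) := mul_le_mul_of_nonneg_left (by linarith) hb
  have hBq : B ≤ B + q := by linarith
  gcongr

theorem sum_ratio_submodular {ι : Type*} [DecidableEq ι] {A B : Finset ι → ℝ} {α β : ι → ℝ}
    (hA : ∀ S, A S = A ∅ + ∑ w ∈ S, α w) (hB : ∀ S, B S = B ∅ + ∑ w ∈ S, β w)
    (hpos : ∀ S, 0 < B S) (hAB : ∀ S, A S ≤ B S) (hβ : ∀ w, 0 ≤ β w) (hβα : ∀ w, β w ≤ α w)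
    {X Y : Finset ι} (hXY : X ⊆ Y) {u : ι} (hu : u ∉ Y) :
    A (insert u Y) / B (insert u Y) - A Y / B Y ≤ A (insert u X) / B (insert u X) - A X / B X := by
  have insert_eq : ∀ {F : Finset ι → ℝ} {φ : ι → ℝ}, (∀ S, F S = F ∅ + ∑ w ∈ S, φ w) →
      ∀ {S}, u ∉ S → F (insert u S) = F S + φ u := by
    intro F φ hF S hS
    rw [hF, hF S, Finset.sum_insert hS]
    ring
  have superset_eq : ∀ {F : Finset ι → ℝ} {φ : ι → ℝ}, (∀ S, F S = F ∅ + ∑ w ∈ S, φ w) →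
      F Y = F X + ∑ w ∈ Y \ X, φ w := by
    intro F φ hF
    rw [hF, hF X, ← Finset.sum_sdiff hXY]
    ring
  have huX : u ∉ X := fun h => hu (hXY h)
  rw [insert_eq hA hu, insert_eq hB hu, insert_eq hA huX, insert_eq hB huX, superset_eq hA,
    superset_eq hB]
  exact div_sub_div_le_of_add (hpos X) (hAB X) (hβ u) (hβα u)
    (Finset.sum_nonneg fun w _ => hβ w) (Finset.sum_le_sum fun w _ => hβα w)

/-- Submodularity part of Proposition 3: fixing a player `i` and the strategies of the other
players, the utility function `s_i ↦ π_i(s_i, s_{-i})` is submodular. -/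
theorem payoff_submodular (m n : ℕ) (hm : 2 ≤ m) (hn : 1 ≤ n)
    (c : Fin n → Fin n → ℝ) (hc : ∀ u v, 0 ≤ c u v)
    (hcsum : ∀ v : Fin n, ∑ u : Fin n, c u v = 1)
    (ε : ℝ) (hε : 0 < ε) (hε' : ε < 1 / (m : ℝ))
    (i : Fin m) (s : Fin m → Finset (Fin n))
    (X Y : Finset (Fin n)) (hXY : X ⊆ Y) (u : Fin n) (hu : u ∉ Y) :
    payoff c ε (Function.update s i (insert u Y)) i
        - payoff c ε (Function.update s i Y) i ≤
      payoff c ε (Function.update s i (insert u X)) i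
        - payoff c ε (Function.update s i X) i := by
  have hm0 : 0 < m := by omega
  have hm1 : (1 : ℝ) ≤ m := by exact_mod_cast hm0
  have hmε : m * ε ≤ 1 := by
    rw [lt_div_iff₀ (by positivity)] at hε'
    linarith
  simp only [payoff, ← mul_sub, ← Finset.sum_sub_distrib]
  refine mul_le_mul_of_nonneg_left (Finset.sum_le_sum fun v _ => ?_) (by positivity)
  refine sum_ratio_submodular
    (A := fun S => fPart c ε (Function.update s i S) i v)
    (B := fun S => fTot c ε (Function.update s i S) v)
    (fun S => fPart_update c ε s i S v) (fun S => fTot_update c ε s i S v)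
    (fun S => fTot_pos hm0 hc hcsum hε hmε _ v) (fun S => fPart_le_fTot hc hε.le _ i v)
    (fun w => ?_) (fun w => ?_) hXY hu
  · split_ifs
    · exact mul_nonneg (sub_nonneg.2 hmε) (hc w v)
    · exact le_rfl
  · split_ifs
    · exact mul_le_mul_of_nonneg_right (by nlinarith) (hc w v)
    · exact div_nonneg (hc w v) (by positivity)
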